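/- Let Δ be an irreducible simply-laced root system of rank greater than 1 in a finite-dimensional real inner product space, with base {α₁, …, α_r} and highest root θ, and set n_i = c_i(θ). Let Γ be a proper subgroup of the Weyl group W(Δ). Then Γ is large if and only if there exist w ∈ W(Δ) and an index i such that either n_i = 1 and w(Δ_Γ) = {α ∈ Δ : c_i(α) = 0}, or n_i = 2 and w(Δ_Γ) = {α ∈ Δ : c_i(α) is even}; that is, Δ_Γ is a maximal proper root subsystem of Δ of characteristic 1 or 2. (Proposition 5.2.6 of the paper, with maximal proper root subsystems of characteristic n described, following Dynkin's classification, as the W-conjugates of the sets {α ∈ Δ : n_i | c_i(α)} with n_i = n.) -/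

import Mathlib

open RealInnerProductSpace

/-- The reflection `s_α(x) = x − (2⟨x,α⟩/⟨α,α⟩)α` as a function. -/
noncomputable def sFun {V : Type*} [NormedAddCommGroup V] [InnerProductSpace ℝ V]
    (α : V) : V → V :=
  fun x => x - (2 * ⟪x, α⟫ / ⟪α, α⟫) • α

/-- The Weyl group of `Δ`: the subgroup of the orthogonal group of `V` generated by the
reflections `s_α`, `α ∈ Δ`. -/
noncomputable def weylGroup {V : Type*} [NormedAddCommGroup V] [InnerProductSpace ℝ V]
    (Δ : Set V) : Subgroup (V ≃ₗᵢ[ℝ] V) :=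
  Subgroup.closure { w : V ≃ₗᵢ[ℝ] V | ∃ α ∈ Δ, ∀ x, w x = sFun α x }

/-- `s_γ ∈ Γ`: some element of `Γ` acts as the reflection `s_γ`. -/
def reflMem {V : Type*} [NormedAddCommGroup V] [InnerProductSpace ℝ V]
    (Γ : Subgroup (V ≃ₗᵢ[ℝ] V)) (γ : V) : Prop :=
  ∃ w ∈ Γ, ∀ x, w x = sFun γ x

/-- `Γ` is large: for any roots `α, β` with `β ≠ ±α` and `⟨α,β⟩ ≠ 0` there is a nonzero
`γ ∈ ℝα + ℝβ` with `s_γ ∈ Γ`. -/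
def IsLarge {V : Type*} [NormedAddCommGroup V] [InnerProductSpace ℝ V]
    (Δ : Set V) (Γ : Subgroup (V ≃ₗᵢ[ℝ] V)) : Prop :=
  ∀ α ∈ Δ, ∀ β ∈ Δ, β ≠ α → β ≠ -α → ⟪α, β⟫ ≠ 0 →
    ∃ γ : V, γ ≠ 0 ∧ (∃ s t : ℝ, γ = s • α + t • β) ∧ reflMem Γ γ

section RootSystems

variable {V : Type*} [NormedAddCommGroup V] [InnerProductSpace ℝ V]

/-- The root system axioms used here, for a simply laced system. -/
structure IsSimplyLaced (Δ : Set V) : Prop where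
  finite : Δ.Finite
  zero_notMem : (0 : V) ∉ Δ
  sFun_mem : ∀ α ∈ Δ, ∀ β ∈ Δ, sFun α β ∈ Δ
  crystallographic : ∀ α ∈ Δ, ∀ β ∈ Δ, ∃ n : ℤ, 2 * ⟪β, α⟫ = (n : ℝ) * ⟪α, α⟫
  norm_eq : ∀ α ∈ Δ, ∀ β ∈ Δ, ‖α‖ = ‖β‖

/-- `b` is a base of `Δ` with coefficient functions `c`. -/
structure IsRootBase (Δ : Set V) {r : ℕ} (b : Fin r → V) (c : Fin r → V → ℤ) : Prop where
  mem : ∀ i, b i ∈ Δ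
  linearIndependent : LinearIndependent ℝ b
  rep : ∀ α ∈ Δ, α = ∑ i, (c i α : ℝ) • b i
  sign : ∀ α ∈ Δ, (∀ i, 0 ≤ c i α) ∨ (∀ i, c i α ≤ 0)

/-! ### Reflections -/

theorem sFun_smul {k : ℝ} (hk : k ≠ 0) (γ x : V) : sFun (k • γ) x = sFun γ x := by
  by_cases hγ : ⟪γ, γ⟫ = 0
  · have : γ = 0 := inner_self_eq_zero.mp hγ
    simp [this]
  · simp only [sFun, real_inner_smul_left, real_inner_smul_right, smul_smul]
    congr 2
    field_simp

theorem sFun_neg (γ x : V) : sFun (-γ) x = sFun γ x := by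
  simpa using sFun_smul (k := -1) (by norm_num) γ x

theorem reflMem_smul_iff {Γ : Subgroup (V ≃ₗᵢ[ℝ] V)} {k : ℝ} (hk : k ≠ 0) (γ : V) :
    reflMem Γ (k • γ) ↔ reflMem Γ γ := by
  simp only [reflMem, sFun_smul hk]

theorem reflMem_neg_iff {Γ : Subgroup (V ≃ₗᵢ[ℝ] V)} (γ : V) :
    reflMem Γ (-γ) ↔ reflMem Γ γ := by
  simp only [reflMem, sFun_neg]

theorem exists_linearIsometryEquiv_eq_sFun (α : V) :
    ∃ w : V ≃ₗᵢ[ℝ] V, ∀ x, w x = sFun α x := by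
  refine ⟨(ℝ ∙ α)ᗮ.reflection, fun x => ?_⟩
  rw [Submodule.reflection_orthogonal_apply, Submodule.reflection_singleton_apply, sFun]
  simp only [real_inner_comm x α, ← real_inner_self_eq_norm_sq, RCLike.ofReal_real_eq_id, id]
  rw [← smul_assoc, neg_sub, nsmul_eq_mul]
  congr 2
  push_cast
  ring

theorem sFun_sFun (α x : V) : sFun α (sFun α x) = x := by
  by_cases hα : ⟪α, α⟫ = 0
  · simp [sFun, inner_self_eq_zero.mp hα]
  · simp only [sFun, inner_sub_left, real_inner_smul_left]
    rw [sub_sub, ← add_smul]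
    convert sub_zero x using 2
    convert zero_smul ℝ α using 2
    field_simp
    ring

theorem reflMem_map {Γ : Subgroup (V ≃ₗᵢ[ℝ] V)} {w : V ≃ₗᵢ[ℝ] V} (hw : w ∈ Γ) {β : V}
    (hβ : reflMem Γ β) : reflMem Γ (w β) := by
  obtain ⟨u, hu, hux⟩ := hβ
  refine ⟨w * u * w⁻¹, Γ.mul_mem (Γ.mul_mem hw hu) (Γ.inv_mem hw), fun x => ?_⟩
  have hx : w (w⁻¹ x) = x := w.apply_symm_apply x
  have h1 : ⟪w⁻¹ x, β⟫ = ⟪x, w β⟫ := by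
    rw [← w.inner_map_map (w⁻¹ x) β, hx]
  change w (u (w⁻¹ x)) = _
  rw [hux, sFun, sFun, map_sub, map_smul, hx, h1, w.inner_map_map]

theorem reflMem_sFun {Γ : Subgroup (V ≃ₗᵢ[ℝ] V)} {α β : V}
    (hα : reflMem Γ α) (hβ : reflMem Γ β) : reflMem Γ (sFun α β) := by
  obtain ⟨u, hu, hux⟩ := hα
  simpa only [hux] using reflMem_map hu hβ

theorem exists_weylGroup_eq_sFun {Δ : Set V} {β : V} (hβ : β ∈ Δ) :
    ∃ w ∈ weylGroup Δ, ∀ x, w x = sFun β x := by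
  obtain ⟨w, hw⟩ := exists_linearIsometryEquiv_eq_sFun β
  exact ⟨w, Subgroup.subset_closure ⟨β, hβ, hw⟩, hw⟩

/-! ### Simply laced root systems -/

namespace IsSimplyLaced

variable {Δ : Set V} {α β : V}

theorem inner_self_pos (hΔ : IsSimplyLaced Δ) (hα : α ∈ Δ) : 0 < ⟪α, α⟫ :=
  real_inner_self_pos.mpr fun h => hΔ.zero_notMem (h ▸ hα)

theorem inner_self_eq (hΔ : IsSimplyLaced Δ) (hα : α ∈ Δ) (hβ : β ∈ Δ) : ⟪β, β⟫ = ⟪α, α⟫ := by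
  rw [real_inner_self_eq_norm_sq, real_inner_self_eq_norm_sq, hΔ.norm_eq β hβ α hα]

theorem neg_mem (hΔ : IsSimplyLaced Δ) (hα : α ∈ Δ) : -α ∈ Δ := by
  have h := hΔ.sFun_mem α hα α hα
  rwa [sFun, mul_div_assoc, div_self (hΔ.inner_self_pos hα).ne', mul_one, two_smul,
    sub_add_cancel_left] at h

theorem sFun_eq (hΔ : IsSimplyLaced Δ) {n : ℝ} (hα : α ∈ Δ) {x : V} (hn : 2 * ⟪x, α⟫ = n * ⟪α, α⟫) :
    sFun α x = x - n • α := by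
  rw [sFun, hn, mul_div_assoc, div_self (hΔ.inner_self_pos hα).ne', mul_one]

/-- Cartan integers lie between `-2` and `2`, and are extremal only for proportional roots. -/
theorem exists_cartan (hΔ : IsSimplyLaced Δ) (hα : α ∈ Δ) (hβ : β ∈ Δ) :
    ∃ n : ℤ, 2 * ⟪α, β⟫ = n * ⟪α, α⟫ ∧ -2 ≤ n ∧ n ≤ 2 ∧ (n = 2 → β = α) ∧ (n = -2 → β = -α) := by
  obtain ⟨n, hn⟩ := hΔ.crystallographic α hα β hβ
  rw [real_inner_comm] at hn
  have hN := hΔ.inner_self_pos hα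
  have hβα := hΔ.inner_self_eq hα hβ
  have h1 : ⟪α - β, α - β⟫ = (2 - n) * ⟪α, α⟫ := by
    rw [real_inner_sub_sub_self, hβα, hn]; ring
  have h2 : ⟪α + β, α + β⟫ = (2 + n) * ⟪α, α⟫ := by
    rw [real_inner_add_add_self, hβα, hn]; ring
  refine ⟨n, hn, ?_, ?_, ?_, ?_⟩
  · have : (0 : ℝ) ≤ 2 + n := nonneg_of_mul_nonneg_left (h2 ▸ real_inner_self_nonneg) hN
    have : (0 : ℤ) ≤ 2 + n := by exact_mod_cast this
    omega
  · have : (0 : ℝ) ≤ 2 - n := nonneg_of_mul_nonneg_left (h1 ▸ real_inner_self_nonneg) hN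
    have : (0 : ℤ) ≤ 2 - n := by exact_mod_cast this
    omega
  · rintro rfl
    norm_num at h1
    exact (sub_eq_zero.mp h1).symm
  · rintro rfl
    norm_num at h2
    exact (neg_eq_of_add_eq_zero_right h2).symm

theorem add_mem (hΔ : IsSimplyLaced Δ) (hα : α ∈ Δ) (hβ : β ∈ Δ) (h : 2 * ⟪α, β⟫ = -⟪α, α⟫) :
    α + β ∈ Δ := by
  have := hΔ.sFun_mem α hα β hβ
  rwa [hΔ.sFun_eq (n := -1) hα (by rw [real_inner_comm, h]; ring), neg_one_smul, sub_neg_eq_add,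
    add_comm] at this

/-- A root in the plane of two roots at angle `2π/3` is one of the six obvious ones. -/
theorem eq_of_mem_plane (hΔ : IsSimplyLaced Δ) (hα : α ∈ Δ) (hβ : β ∈ Δ) (h : 2 * ⟪α, β⟫ = -⟪α, α⟫)
    {ρ : V}
    (hρ : ρ ∈ Δ) {x y : ℝ} (hxy : ρ = x • α + y • β) :
    ρ = α ∨ ρ = -α ∨ ρ = β ∨ ρ = -β ∨ ρ = α + β ∨ ρ = -(α + β) := by
  obtain ⟨p, hp, hp1, hp2, -, -⟩ := hΔ.exists_cartan hα hρ
  obtain ⟨q, hq, hq1, hq2, -, -⟩ := hΔ.exists_cartan hβ hρ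
  have hN := hΔ.inner_self_pos hα
  have hβα := hΔ.inner_self_eq hα hβ
  have hρα := hΔ.inner_self_eq hα hρ
  have hβα' : ⟪β, α⟫ = ⟪α, β⟫ := real_inner_comm _ _
  simp only [hxy, inner_add_left, inner_add_right, real_inner_smul_left, real_inner_smul_right,
    hβα, hβα'] at hp hq hρα
  have hp' : 2 * x - y = p := mul_right_cancel₀ hN.ne' (by linear_combination hp - y * h)
  have hq' : 2 * y - x = q := mul_right_cancel₀ hN.ne' (by linear_combination hq - x * h)
  have hnorm : x ^ 2 - x * y + y ^ 2 = 1 :=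
    mul_right_cancel₀ hN.ne' (by linear_combination hρα - x * y * h)
  have hx : x = (2 * p + q) / 3 := by linarith
  have hy : y = (p + 2 * q) / 3 := by linarith
  have hpq : p ^ 2 + p * q + q ^ 2 = 3 := by
    have : (p : ℝ) ^ 2 + p * q + q ^ 2 = 3 := by
      rw [hx, hy] at hnorm
      linear_combination 3 * hnorm
    exact_mod_cast this
  have hcases : (p = 2 ∧ q = -1) ∨ (p = -2 ∧ q = 1) ∨ (p = -1 ∧ q = 2) ∨ (p = 1 ∧ q = -2) ∨
      (p = 1 ∧ q = 1) ∨ (p = -1 ∧ q = -1) := by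
    interval_cases p <;> interval_cases q <;> simp_all
  rcases hcases with ⟨rfl, rfl⟩ | ⟨rfl, rfl⟩ | ⟨rfl, rfl⟩ | ⟨rfl, rfl⟩ | ⟨rfl, rfl⟩ | ⟨rfl, rfl⟩ <;>
    norm_num at hx hy <;> subst hx hy <;> simp [hxy, add_comm]

/-! ### The Weyl group -/

theorem weylGroup_mem_iff (hΔ : IsSimplyLaced Δ) {w : V ≃ₗᵢ[ℝ] V} (hw : w ∈ weylGroup Δ) (α : V) :
    w α ∈ Δ ↔ α ∈ Δ := by
  induction hw using Subgroup.closure_induction generalizing α with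
  | mem w hw =>
    obtain ⟨γ, hγ, hw⟩ := hw
    rw [hw]
    exact ⟨fun h => sFun_sFun γ α ▸ hΔ.sFun_mem γ hγ _ h, hΔ.sFun_mem γ hγ α⟩
  | one => rfl
  | mul u v _ _ hu hv => exact (hu _).trans (hv _)
  | inv u _ hu => rw [← hu, show u (u⁻¹ α) = α from u.apply_symm_apply α]

/-- The pairing of two elements of the root lattice is an integer multiple of half the squared
length of a root. -/
theorem exists_two_inner_eq_of_mem_closure (hΔ : IsSimplyLaced Δ) (hα : α ∈ Δ) {x y : V}
    (hx : x ∈ AddSubgroup.closure Δ) (hy : y ∈ AddSubgroup.closure Δ) :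
    ∃ n : ℤ, 2 * ⟪x, y⟫ = n * ⟪α, α⟫ := by
  induction hx, hy using AddSubgroup.closure_induction₂ with
  | mem x y hx hy =>
    obtain ⟨n, hn⟩ := hΔ.crystallographic y hy x hx
    exact ⟨n, by rw [hn, hΔ.inner_self_eq hα hy]⟩
  | zero_left => exact ⟨0, by simp⟩
  | zero_right => exact ⟨0, by simp⟩
  | add_left x y z _ _ _ h₁ h₂ =>
    obtain ⟨n, hn⟩ := h₁
    obtain ⟨m, hm⟩ := h₂
    exact ⟨n + m, by rw [inner_add_left]; push_cast; linear_combination hn + hm⟩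
  | add_right x y z _ _ _ h₁ h₂ =>
    obtain ⟨n, hn⟩ := h₁
    obtain ⟨m, hm⟩ := h₂
    exact ⟨n + m, by rw [inner_add_right]; push_cast; linear_combination hn + hm⟩
  | neg_left x y _ _ h =>
    obtain ⟨n, hn⟩ := h
    exact ⟨-n, by rw [inner_neg_left]; push_cast; linear_combination -hn⟩
  | neg_right x y _ _ h =>
    obtain ⟨n, hn⟩ := h
    exact ⟨-n, by rw [inner_neg_right]; push_cast; linear_combination -hn⟩

/-- The Weyl group moves weights by elements of the root lattice. -/
theorem weylGroup_sub_mem_closure (hΔ : IsSimplyLaced Δ) {w : V ≃ₗᵢ[ℝ] V} (hw : w ∈ weylGroup Δ)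
    (x : V)
    (hx : ∀ α ∈ Δ, ∃ n : ℤ, 2 * ⟪x, α⟫ = n * ⟪α, α⟫) : w x - x ∈ AddSubgroup.closure Δ := by
  have weight : ∀ {u : V ≃ₗᵢ[ℝ] V}, u ∈ weylGroup Δ → ∀ {x : V},
      (∀ α ∈ Δ, ∃ n : ℤ, 2 * ⟪x, α⟫ = n * ⟪α, α⟫) →
      ∀ α ∈ Δ, ∃ n : ℤ, 2 * ⟪u x, α⟫ = n * ⟪α, α⟫ := by
    intro u hu x hx α hα
    have h : u (u⁻¹ α) = α := u.apply_symm_apply α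
    obtain ⟨n, hn⟩ := hx (u⁻¹ α) ((hΔ.weylGroup_mem_iff (inv_mem hu) α).mpr hα)
    refine ⟨n, ?_⟩
    rwa [← u.inner_map_map x, ← u.inner_map_map (u⁻¹ α), h] at hn
  induction hw using Subgroup.closure_induction generalizing x with
  | mem w hw =>
    obtain ⟨γ, hγ, hw⟩ := hw
    obtain ⟨n, hn⟩ := hx γ hγ
    rw [hw, hΔ.sFun_eq hγ hn, sub_sub_cancel_left, Int.cast_smul_eq_zsmul]
    exact AddSubgroup.neg_mem _ (AddSubgroup.zsmul_mem _ (AddSubgroup.subset_closure hγ) n)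
  | one => simp
  | mul u v _ hv hu' hv' =>
    have h := AddSubgroup.add_mem _ (hu' (v x) (weight hv hx)) (hv' x hx)
    rwa [sub_add_sub_cancel] at h
  | inv u hu hu' =>
    have h := AddSubgroup.neg_mem _ (hu' (u⁻¹ x) (weight (inv_mem hu) hx))
    rwa [neg_sub, show u (u⁻¹ x) = x from u.apply_symm_apply x] at h

theorem sum_comp_weylGroup (hΔ : IsSimplyLaced Δ) {w : V ≃ₗᵢ[ℝ] V} (hw : w ∈ weylGroup Δ)
    (f : V → ℝ) :
    ∑ α ∈ hΔ.finite.toFinset, f (w α) = ∑ α ∈ hΔ.finite.toFinset, f α :=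
  Finset.sum_nbij' w (⇑w⁻¹)
    (fun α hα => by simpa [hΔ.weylGroup_mem_iff hw] using hα)
    (fun α hα => hΔ.finite.mem_toFinset.mpr
      ((hΔ.weylGroup_mem_iff (inv_mem hw) α).mpr (hΔ.finite.mem_toFinset.mp hα)))
    (fun α _ => w.symm_apply_apply α) (fun α _ => w.apply_symm_apply α) (fun _ _ => rfl)

/-- If translating `x` by twice the coroot of `β` does not decrease the energy
`∑ α, ⟪x, α⟫ ^ 2`, then `⟪x, β⟫ ≤ 2`. -/
theorem inner_le_two (hΔ : IsSimplyLaced Δ) (hβ : β ∈ Δ) {x : V}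
    (h : ∑ α ∈ hΔ.finite.toFinset, ⟪x, α⟫ ^ 2 ≤
      ∑ α ∈ hΔ.finite.toFinset, ⟪x - (4 / ⟪β, β⟫) • β, α⟫ ^ 2) : ⟪x, β⟫ ≤ 2 := by
  have hN := hΔ.inner_self_pos hβ
  by_contra! hlt
  set F := hΔ.finite.toFinset
  have expand : ∀ k : ℝ, ∑ α ∈ F, (⟪x, α⟫ - k * ⟪β, α⟫) ^ 2 =
      ∑ α ∈ F, ⟪x, α⟫ ^ 2 - 2 * k * ∑ α ∈ F, ⟪x, α⟫ * ⟪β, α⟫ + k ^ 2 * ∑ α ∈ F, ⟪β, α⟫ ^ 2 := by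
    intro k
    rw [Finset.mul_sum, Finset.mul_sum, ← Finset.sum_sub_distrib, ← Finset.sum_add_distrib]
    exact Finset.sum_congr rfl fun α _ => by ring
  have hC : 0 < ∑ α ∈ F, ⟪β, α⟫ ^ 2 :=
    Finset.sum_pos' (fun _ _ => sq_nonneg _)
      ⟨β, hΔ.finite.mem_toFinset.mpr hβ, pow_pos hN 2⟩
  obtain ⟨w, hw, hwβ⟩ := exists_weylGroup_eq_sFun hβ
  have hinv := hΔ.sum_comp_weylGroup hw fun α => ⟪x, α⟫ ^ 2
  have hwα : ∀ α, ⟪x, w α⟫ = ⟪x, α⟫ - 2 * ⟪x, β⟫ / ⟪β, β⟫ * ⟪β, α⟫ := by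
    intro α
    rw [hwβ, sFun, inner_sub_right, real_inner_smul_right, real_inner_comm α β]
    ring
  simp only [hwα] at hinv
  rw [expand] at hinv
  simp only [inner_sub_left, real_inner_smul_left, expand] at h
  set B := ∑ α ∈ F, ⟪x, α⟫ * ⟪β, α⟫
  set C := ∑ α ∈ F, ⟪β, α⟫ ^ 2
  set k := 2 * ⟪x, β⟫ / ⟪β, β⟫ with hk
  set l := 4 / ⟪β, β⟫ with hl
  have hl0 : 0 < l := by positivity
  have hlk : l < k := by
    rw [hk, hl]
    gcongr
    linarith
  have hB : 2 * B = k * C := by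
    refine mul_left_cancel₀ (hl0.trans hlk).ne' ?_
    linarith
  have hpos : 0 < l * ((k - l) * C) := mul_pos hl0 (mul_pos (sub_pos.mpr hlk) hC)
  have : l * (2 * B) = l * (k * C) := by rw [hB]
  linarith

end IsSimplyLaced

/-! ### Bases -/

namespace IsRootBase

variable {Δ : Set V} {r : ℕ} {b : Fin r → V} {c : Fin r → V → ℤ}

theorem coeff_unique (hb : IsRootBase Δ b c) {x y : Fin r → ℤ}
    (h : ∑ i, (x i : ℝ) • b i = ∑ i, (y i : ℝ) • b i) : x = y := by
  have h' := Fintype.linearIndependent_iff.mp hb.linearIndependent (fun i => (x i : ℝ) - y i)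
    (by simp only [sub_smul, Finset.sum_sub_distrib, h, sub_self])
  funext i
  exact_mod_cast sub_eq_zero.mp (h' i)

theorem coeff_eq (hb : IsRootBase Δ b c) {α : V} (hα : α ∈ Δ) {x : Fin r → ℤ}
    (h : α = ∑ i, (x i : ℝ) • b i) (i : Fin r) : c i α = x i :=
  congrFun (hb.coeff_unique (x := fun i => c i α) ((hb.rep α hα).symm.trans h)) i

theorem coeff_self (hb : IsRootBase Δ b c) (i j : Fin r) : c i (b j) = if i = j then 1 else 0 :=
  hb.coeff_eq (hb.mem j) (x := fun i => if i = j then 1 else 0) (by simp) i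

theorem coeff_add (hb : IsRootBase Δ b c) {α β : V} (hα : α ∈ Δ) (hβ : β ∈ Δ) (hαβ : α + β ∈ Δ)
    (i : Fin r) : c i (α + β) = c i α + c i β :=
  hb.coeff_eq hαβ (x := fun i => c i α + c i β) (by
    conv_lhs => rw [hb.rep α hα, hb.rep β hβ]
    simp [add_smul, Finset.sum_add_distrib]) i

theorem coeff_neg (hb : IsRootBase Δ b c) {α : V} (hα : α ∈ Δ) (hα' : -α ∈ Δ) (i : Fin r) :
    c i (-α) = -c i α :=
  hb.coeff_eq hα' (x := fun i => -c i α) (by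
    conv_lhs => rw [hb.rep α hα]
    simp [neg_smul]) i

theorem inner_eq_sum (hb : IsRootBase Δ b c) {α : V} (hα : α ∈ Δ) (x : V) :
    ⟪x, α⟫ = ∑ i, (c i α : ℝ) * ⟪x, b i⟫ := by
  conv_lhs => rw [hb.rep α hα]
  simp [inner_sum, real_inner_smul_right]

theorem exists_coeff_of_mem_closure (hb : IsRootBase Δ b c) {x : V}
    (hx : x ∈ AddSubgroup.closure Δ) :
    ∃ d : Fin r → ℤ, x = ∑ i, (d i : ℝ) • b i := by
  induction hx using AddSubgroup.closure_induction with
  | mem α hα => exact ⟨fun i => c i α, hb.rep α hα⟩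
  | zero => exact ⟨0, by simp⟩
  | add x y _ _ hx hy =>
    obtain ⟨d, rfl⟩ := hx
    obtain ⟨e, rfl⟩ := hy
    exact ⟨d + e, by simp [add_smul, Finset.sum_add_distrib]⟩
  | neg x _ hx =>
    obtain ⟨d, rfl⟩ := hx
    exact ⟨-d, by simp [neg_smul]⟩

/-- There is a vector with prescribed inner products with the base, in its span. -/
theorem exists_dual (hb : IsRootBase Δ b c) (m : Fin r → ℝ) :
    ∃ y : Fin r → ℝ, ∀ i, ⟪∑ j, y j • b j, b i⟫ = m i := by
  have : FiniteDimensional ℝ (Submodule.span ℝ (Set.range b)) :=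
    FiniteDimensional.span_of_finite ℝ (Set.finite_range b)
  let B := Module.Basis.span hb.linearIndependent
  let f := (B.constr ℝ m).toContinuousLinearMap
  let x := (InnerProductSpace.toDual ℝ (Submodule.span ℝ (Set.range b))).symm f
  obtain ⟨y, hy⟩ := (Submodule.mem_span_range_iff_exists_fun ℝ).mp x.2
  refine ⟨y, fun i => ?_⟩
  rw [hy, show b i = B i by rw [Module.Basis.span_apply],
    ← Submodule.coe_inner, InnerProductSpace.toDual_symm_apply]
  exact B.constr_basis ℝ m i

/-- No element of the Weyl group is the reflection in a root lattice vector of norm `√3` times that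
of the roots. -/
theorem ne_sFun_of_inner_self_eq (hb : IsRootBase Δ b c) (hΔ : IsSimplyLaced Δ) {α : V}
    (hα : α ∈ Δ) {δ : V}
    (hδ : δ ∈ AddSubgroup.closure Δ) (hnorm : ⟪δ, δ⟫ = 3 * ⟪α, α⟫) {w : V ≃ₗᵢ[ℝ] V}
    (hw : w ∈ weylGroup Δ) : ¬ ∀ x, w x = sFun δ x := by
  intro hwδ
  have hN := hΔ.inner_self_pos hα
  obtain ⟨d, hd⟩ := hb.exists_coeff_of_mem_closure hδ
  have hdvd : ∀ i, (3 : ℤ) ∣ d i := by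
    intro i
    obtain ⟨y, hy⟩ := hb.exists_dual (fun j => if j = i then ⟪α, α⟫ / 2 else 0)
    set ω := ∑ j, y j • b j
    have hω : ∀ β ∈ Δ, ∃ n : ℤ, 2 * ⟪ω, β⟫ = n * ⟪β, β⟫ := fun β hβ => ⟨c i β, by
      rw [hb.inner_eq_sum hβ, hΔ.inner_self_eq hα hβ]
      simp only [hy, mul_ite, mul_zero, Finset.sum_ite_eq', Finset.mem_univ, if_true]
      ring⟩
    have hωδ : ⟪ω, δ⟫ = d i * (⟪α, α⟫ / 2) := by
      rw [hd]
      simp [inner_sum, real_inner_smul_right, hy]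
    have hmem := hΔ.weylGroup_sub_mem_closure hw ω hω
    obtain ⟨e, he⟩ := hb.exists_coeff_of_mem_closure hmem
    have hcoef : (2 * ⟪ω, δ⟫ / ⟪δ, δ⟫) = (d i : ℝ) / 3 := by
      rw [hωδ, hnorm]
      field_simp
    rw [hwδ, sFun, hcoef, sub_sub_cancel_left, ← neg_smul] at he
    have key := hb.coeff_unique (x := fun j => d i * d j) (y := fun j => -3 * e j) (by
      have : (-3 : ℝ) • (-((d i : ℝ) / 3) • δ) = (-3 : ℝ) • ∑ j, (e j : ℝ) • b j := by
        rw [he]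
      rw [smul_smul, Finset.smul_sum] at this
      have h3 : (-3 : ℝ) * -((d i : ℝ) / 3) = d i := by ring
      rw [h3, hd, Finset.smul_sum] at this
      simpa [smul_smul] using this)
    have hsq : (3 : ℤ) ∣ d i * d i := ⟨-e i, by linarith [congrFun key i]⟩
    exact (Int.prime_three.dvd_or_dvd hsq).elim id id
  choose f hf using hdvd
  have hμ : ∑ i, (f i : ℝ) • b i ∈ AddSubgroup.closure Δ := by
    refine AddSubgroup.sum_mem _ fun i _ => ?_
    rw [Int.cast_smul_eq_zsmul]
    exact AddSubgroup.zsmul_mem _ (AddSubgroup.subset_closure (hb.mem i)) _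
  have hδμ : δ = (3 : ℝ) • ∑ i, (f i : ℝ) • b i := by
    rw [hd, Finset.smul_sum]
    simp [hf, smul_smul]
  obtain ⟨k, hk⟩ := hΔ.exists_two_inner_eq_of_mem_closure hα hμ hμ
  rw [hδμ, real_inner_smul_left, real_inner_smul_right] at hnorm
  have h23 : (2 : ℝ) = 3 * k := mul_right_cancel₀ hN.ne' (by linarith)
  have : (2 : ℤ) = 3 * k := by exact_mod_cast h23
  omega

/-- A reflection in the Weyl group along a vector in the plane of two roots at angle `2π/3` is the
reflection in a root of that plane. -/
theorem reflMem_of_mem_plane (hb : IsRootBase Δ b c) (hΔ : IsSimplyLaced Δ)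
    {Γ : Subgroup (V ≃ₗᵢ[ℝ] V)}
    (hΓ : Γ ≤ weylGroup Δ) {α β : V} (hα : α ∈ Δ) (hβ : β ∈ Δ) (h : 2 * ⟪α, β⟫ = -⟪α, α⟫)
    {γ : V} (hγ0 : γ ≠ 0) {s t : ℝ} (hst : γ = s • α + t • β) (hγ : reflMem Γ γ) :
    reflMem Γ α ∨ reflMem Γ β ∨ reflMem Γ (α + β) := by
  obtain ⟨w, hw, hwγ⟩ := id hγ
  have hN := hΔ.inner_self_pos hα
  have hβα := hΔ.inner_self_eq hα hβ
  have hcomm : ⟪β, α⟫ = ⟪α, β⟫ := real_inner_comm _ _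
  have hLα := AddSubgroup.subset_closure hα
  have hLβ := AddSubgroup.subset_closure hβ
  have transfer : ∀ {k : ℝ} {v : V}, v ≠ 0 → v = k • γ → reflMem Γ v := by
    rintro k v hv rfl
    exact (reflMem_smul_iff (left_ne_zero_of_smul hv) γ).mpr hγ
  have bad : ∀ {k : ℝ} {v : V}, v = k • γ → v ∈ AddSubgroup.closure Δ →
      ⟪v, v⟫ = 3 * ⟪α, α⟫ → False := by
    intro k v hv hvL hvn
    have hv0 : v ≠ 0 := by
      rintro rfl
      rw [inner_zero_left] at hvn
      linarith
    obtain ⟨u, hu, huv⟩ := transfer hv0 hv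
    exact hb.ne_sFun_of_inner_self_eq hΔ hα hvL hvn (hΓ hu) huv
  have hρΔ : sFun γ α ∈ Δ := hwγ α ▸ (hΔ.weylGroup_mem_iff (hΓ hw) α).mpr hα
  set k := 2 * ⟪α, γ⟫ / ⟪γ, γ⟫ with hk
  have hρ : sFun γ α = α - k • γ := rfl
  have hρ' : sFun γ α = (1 - k * s) • α + (-(k * t)) • β := by rw [hρ, hst]; module
  have ne0 : ∀ {v : V}, v ∈ Δ → v ≠ 0 := fun hv h0 => hΔ.zero_notMem (h0 ▸ hv)
  rcases hΔ.eq_of_mem_plane hα hβ h hρΔ hρ' with h1 | h1 | h1 | h1 | h1 | h1 <;> rw [hρ] at h1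
  · exfalso
    have hkγ : k • γ = 0 := by simpa using h1
    have hk0 : k = 0 := (smul_eq_zero.mp hkγ).resolve_right hγ0
    have hαγ : ⟪α, γ⟫ = 0 := by
      rcases div_eq_zero_iff.mp (hk ▸ hk0) with h' | h'
      · linarith
      · exact absurd (inner_self_eq_zero.mp h') hγ0
    rw [hst, inner_add_right, real_inner_smul_right, real_inner_smul_right] at hαγ
    have hts : t = 2 * s := mul_right_cancel₀ hN.ne' (by linear_combination -2 * hαγ + t * h)
    have hs : s ≠ 0 := by
      rintro rfl
      exact hγ0 (by rw [hst, hts]; simp)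
    refine bad (k := s⁻¹) (v := α + (β + β)) ?_ (add_mem hLα (add_mem hLβ hLβ)) ?_
    · rw [hst, hts, smul_add, smul_smul, smul_smul, inv_mul_cancel₀ hs, one_smul,
        mul_left_comm, inv_mul_cancel₀ hs, mul_one, two_smul]
    · simp only [inner_add_left, inner_add_right, hβα, hcomm]
      linear_combination 2 * h
  · left
    refine transfer (k := k / 2) (ne0 hα) ?_
    linear_combination (norm := module) (1 / 2 : ℝ) • h1
  · exfalso
    refine bad (k := k) (v := α - β) ?_ (sub_mem hLα hLβ) ?_
    · linear_combination (norm := module) h1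
    · simp only [inner_sub_left, inner_sub_right, hβα, hcomm]
      linear_combination -h
  · right; right
    refine transfer (k := k) (ne0 (hΔ.add_mem hα hβ h)) ?_
    linear_combination (norm := module) h1
  · right; left
    refine transfer (k := -k) (ne0 hβ) ?_
    linear_combination (norm := module) -h1
  · exfalso
    refine bad (k := k) (v := α + α + β) ?_ (add_mem (add_mem hLα hLα) hLβ) ?_
    · linear_combination (norm := module) h1
    · simp only [inner_add_left, inner_add_right, hβα, hcomm]
      linear_combination 2 * h

/-- Every vector is moved to the dominant chamber by the Weyl group. -/
theorem exists_dominant (hb : IsRootBase Δ b c) (hΔ : IsSimplyLaced Δ) (x : V) :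
    ∃ w ∈ weylGroup Δ, ∀ i, 0 ≤ ⟪x, w (b i)⟫ := by
  obtain ⟨y, hy⟩ := hb.exists_dual fun _ => 1
  let T : Set (Fin r → V) := {f | ∃ w ∈ weylGroup Δ, f = fun i => w (b i)}
  have hT : T.Finite := by
    refine (Set.Finite.pi' fun _ : Fin r => hΔ.finite).subset ?_
    rintro _ ⟨w, hw, rfl⟩ i
    exact (hΔ.weylGroup_mem_iff hw _).mpr (hb.mem i)
  have hsum : ∀ w : V ≃ₗᵢ[ℝ] V, ∑ i, y i * ⟪x, w (b i)⟫ = ⟪x, w (∑ i, y i • b i)⟫ := fun w => by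
    simp [inner_sum, real_inner_smul_right]
  obtain ⟨_, ⟨w, hw, rfl⟩, hmax⟩ := Set.exists_max_image T (fun f => ∑ i, y i * ⟪x, f i⟫) hT
    ⟨_, 1, one_mem _, rfl⟩
  refine ⟨w, hw, fun i => ?_⟩
  obtain ⟨s, hs, hsx⟩ := exists_weylGroup_eq_sFun (hb.mem i)
  have h := hmax _ ⟨w * s, mul_mem hw hs, rfl⟩
  simp only [hsum] at h
  rw [show (w * s) (∑ i, y i • b i) = w (s (∑ i, y i • b i)) from rfl, hsx, sFun, hy, map_sub,
    map_smul, inner_sub_right, real_inner_smul_right] at h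
  have hN := hΔ.inner_self_pos (hb.mem i)
  exact nonneg_of_mul_nonneg_right (by linarith) (show 0 < 2 * 1 / ⟪b i, b i⟫ by positivity)

/-- A predicate on roots that is additive modulo `2` is the parity of the pairing with a
coweight. -/
theorem exists_inner_even_iff (hb : IsRootBase Δ b c) (hΔ : IsSimplyLaced Δ) {p : V → Prop}
    (hneg : ∀ α, p (-α) ↔ p α)
    (hadd : ∀ α ∈ Δ, ∀ β ∈ Δ, 2 * ⟪α, β⟫ = -⟪α, α⟫ → (p (α + β) ↔ (p α ↔ p β))) :
    ∃ x : V, ∀ α ∈ Δ, ∃ n : ℤ, ⟪x, α⟫ = n ∧ (p α ↔ Even n) := by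
  classical
  obtain ⟨y, hy⟩ := hb.exists_dual fun i => if p (b i) then 0 else 1
  set x := ∑ j, y j • b j
  have simple : ∀ i, ∃ n : ℤ, ⟪x, b i⟫ = n ∧ (p (b i) ↔ Even n) := fun i =>
    ⟨if p (b i) then 0 else 1, by rw [hy]; split_ifs <;> simp, by split_ifs <;> simp [*]⟩
  have positive : ∀ k : ℕ, ∀ α ∈ Δ, (∀ i, 0 ≤ c i α) → ∑ i, c i α = k →
      ∃ n : ℤ, ⟪x, α⟫ = n ∧ (p α ↔ Even n) := by
    intro k
    induction k with
    | zero =>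
      intro α hα hpos hsum
      refine absurd ?_ (hΔ.inner_self_pos hα).ne'
      have h0 := (Finset.sum_eq_zero_iff_of_nonneg fun i _ => hpos i).mp hsum
      rw [hb.inner_eq_sum hα]
      exact Finset.sum_eq_zero fun i hi => by rw [h0 i hi]; simp
    | succ k ih =>
      intro α hα hpos hsum
      obtain ⟨i, hi⟩ : ∃ i, 0 < ⟪α, b i⟫ := by
        by_contra! hle
        refine absurd (hΔ.inner_self_pos hα) (not_lt.mpr ?_)
        rw [hb.inner_eq_sum hα]
        exact Finset.sum_nonpos fun i _ =>
          mul_nonpos_of_nonneg_of_nonpos (by exact_mod_cast hpos i) (hle i)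
      have hN := hΔ.inner_self_pos hα
      obtain ⟨n, hn, -, hn2, hn2', -⟩ := hΔ.exists_cartan hα (hb.mem i)
      have hn0 : 0 < n := by
        have : (0 : ℝ) < n := pos_of_mul_pos_left (hn ▸ by positivity) hN.le
        exact_mod_cast this
      obtain rfl | rfl : n = 1 ∨ n = 2 := by omega
      · have hiN := hΔ.inner_self_eq hα (hb.mem i)
        have hbi := hΔ.neg_mem (hb.mem i)
        have hβ : α + -b i ∈ Δ :=
          hΔ.add_mem hα hbi (by rw [inner_neg_right, mul_neg, hn]; simp)
        have hc : ∀ j, c j (α + -b i) = c j α - if j = i then 1 else 0 := fun j => by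
          rw [hb.coeff_add hα hbi hβ, hb.coeff_neg (hb.mem i) hbi, hb.coeff_self, sub_eq_add_neg]
        have hsum' : ∑ j, c j (α + -b i) = k := by
          simp [hc, hsum]
        have hpos' : ∀ j, 0 ≤ c j (α + -b i) := by
          rcases hb.sign _ hβ with h | h
          · exact h
          · intro j
            have h0 : ∑ j, c j (α + -b i) = 0 :=
              le_antisymm (Finset.sum_nonpos fun j _ => h j) (hsum' ▸ Int.natCast_nonneg k)
            exact ((Finset.sum_eq_zero_iff_of_nonpos fun j _ => h j).mp h0 j (Finset.mem_univ j)).ge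
        obtain ⟨l, hl, hpl⟩ := ih _ hβ hpos' hsum'
        obtain ⟨m, hm, hpm⟩ := simple i
        have hadd' := hadd _ hβ _ (hb.mem i) (by
          rw [hΔ.inner_self_eq hα hβ, inner_add_left, inner_neg_left, hiN]
          push_cast at hn
          linarith)
        rw [neg_add_cancel_right] at hadd'
        rw [inner_add_right, inner_neg_right, hm] at hl
        refine ⟨l + m, by push_cast; linarith, ?_⟩
        rw [hadd', hpl, hpm, Int.even_add]
      · exact hn2' rfl ▸ simple i
  refine ⟨x, fun α hα => ?_⟩
  rcases hb.sign α hα with h | h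
  · exact positive _ α hα h (Int.toNat_of_nonneg (Finset.sum_nonneg fun i _ => h i)).symm
  · have hα' := hΔ.neg_mem hα
    have h' : ∀ i, 0 ≤ c i (-α) := fun i => by
      rw [hb.coeff_neg hα hα']
      exact neg_nonneg.mpr (h i)
    obtain ⟨n, hn, hpn⟩ :=
      positive _ _ hα' h' (Int.toNat_of_nonneg (Finset.sum_nonneg fun i _ => h' i)).symm
    rw [inner_neg_right] at hn
    refine ⟨-n, by push_cast; linarith, ?_⟩
    rw [even_neg, ← hpn, hneg]

/-- A predicate on roots that is additive modulo `2` and not always true is, up to the Weyl group,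
the parity of a coefficient whose value on the highest root is `1` or `2`. -/
theorem exists_even_coeff_iff (hb : IsRootBase Δ b c) (hΔ : IsSimplyLaced Δ) {θ : V} (hθ : θ ∈ Δ)
    (hhigh : ∀ α ∈ Δ, ∀ i, c i α ≤ c i θ) {p : V → Prop} (hneg : ∀ α, p (-α) ↔ p α)
    (hadd : ∀ α ∈ Δ, ∀ β ∈ Δ, 2 * ⟪α, β⟫ = -⟪α, α⟫ → (p (α + β) ↔ (p α ↔ p β)))
    (hp : ∃ α ∈ Δ, ¬ p α) :
    ∃ w ∈ weylGroup Δ, ∃ i, (c i θ = 1 ∨ c i θ = 2) ∧ ∀ α ∈ Δ, (p (w α) ↔ Even (c i α)) := by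
  classical
  let P : V → Prop := fun x => ∀ α ∈ Δ, ∃ n : ℤ, ⟪x, α⟫ = n ∧ (p α ↔ Even n)
  let E : V → ℝ := fun x => ∑ α ∈ hΔ.finite.toFinset, ⟪x, α⟫ ^ 2
  obtain ⟨x, hx, hmin⟩ : ∃ x, P x ∧ ∀ x', P x' → E x ≤ E x' := by
    have hnat : ∀ x, P x → ∃ k : ℕ, E x = k := by
      intro x hx
      have : E x ∈ AddMonoidHom.mrange (Nat.castAddMonoidHom ℝ) := by
        refine sum_mem fun α hα => ?_
        obtain ⟨n, hn, -⟩ := hx α (hΔ.finite.mem_toFinset.mp hα)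
        exact ⟨n.natAbs ^ 2, by simp [hn, Nat.cast_natAbs]⟩
      obtain ⟨k, hk⟩ := this
      exact ⟨k, hk.symm⟩
    obtain ⟨x₀, hx₀⟩ := hb.exists_inner_even_iff hΔ hneg hadd
    have hex : ∃ k : ℕ, ∃ x, P x ∧ E x = k := by
      obtain ⟨k, hk⟩ := hnat x₀ hx₀
      exact ⟨k, x₀, hx₀, hk⟩
    obtain ⟨x, hx, hxE⟩ := Nat.find_spec hex
    refine ⟨x, hx, fun x' hx' => ?_⟩
    obtain ⟨k, hk⟩ := hnat x' hx'
    rw [hxE, hk]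
    exact_mod_cast Nat.find_min' hex ⟨x', hx', hk⟩
  have hle : ∀ β ∈ Δ, ⟪x, β⟫ ≤ 2 := by
    refine fun β hβ => hΔ.inner_le_two hβ (hmin _ fun α hα => ?_)
    obtain ⟨n, hn, hpn⟩ := hx α hα
    obtain ⟨m, hm, -⟩ := hΔ.exists_cartan hβ hα
    have hN := hΔ.inner_self_pos hβ
    refine ⟨n - 2 * m, ?_, by rw [hpn]; simp [Int.even_sub]⟩
    rw [inner_sub_left, real_inner_smul_left, hn]
    push_cast
    congr 1
    field_simp
    linarith
  obtain ⟨w, hw, hdom⟩ := hb.exists_dominant hΔ x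
  have hwΔ : ∀ {α}, α ∈ Δ → w α ∈ Δ := (hΔ.weylGroup_mem_iff hw _).mpr
  choose m hm using fun i => hx _ (hwΔ (hb.mem i))
  have hm0 : ∀ i, 0 ≤ m i := fun i => by
    have := hdom i
    rw [(hm i).1] at this
    exact_mod_cast this
  have hL : ∀ α ∈ Δ, ⟪x, w α⟫ = ((∑ i, c i α * m i : ℤ) : ℝ) := by
    intro α hα
    conv_lhs => rw [hb.rep α hα]
    simp [inner_sum, real_inner_smul_right, hm]
  have hpL : ∀ α ∈ Δ, (p (w α) ↔ Even (∑ i, c i α * m i)) := by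
    intro α hα
    obtain ⟨n, hn, hpn⟩ := hx _ (hwΔ hα)
    rw [hL α hα] at hn
    rw [hpn, Int.cast_injective hn]
  have hc1 : ∀ i, 1 ≤ c i θ := fun i => by
    simpa [hb.coeff_self] using hhigh _ (hb.mem i) i
  have hLθ : ∑ i, c i θ * m i ≤ 2 := by
    have := hle _ (hwΔ hθ)
    rw [hL θ hθ] at this
    exact_mod_cast this
  have hterm : ∀ i, 0 ≤ c i θ * m i := fun i =>
    mul_nonneg (zero_le_one.trans (hc1 i)) (hm0 i)
  obtain ⟨i, hi⟩ : ∃ i, ¬ Even (m i) := by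
    by_contra! hall
    obtain ⟨α, hα, hpα⟩ := hp
    have hw' : w (w⁻¹ α) = α := w.apply_symm_apply α
    have := hpL _ ((hΔ.weylGroup_mem_iff (inv_mem hw) α).mpr hα)
    rw [hw'] at this
    exact hpα (this.mpr (Finset.even_sum _ fun i _ => (hall i).mul_left _))
  have hmi : 1 ≤ m i := by
    have : m i ≠ 0 := fun h => hi (by simp [h])
    have := hm0 i
    omega
  have hi2 : c i θ * m i ≤ 2 :=
    (Finset.single_le_sum (fun j _ => hterm j) (Finset.mem_univ i)).trans hLθ
  have hmi1 : m i = 1 := by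
    have h2 : m i ≠ 2 := fun h => hi (by simp [h])
    have : m i ≤ 2 := by nlinarith [hc1 i]
    omega
  have hzero : ∀ j, j ≠ i → m j = 0 := by
    intro j hji
    by_contra hj
    have hmj : 1 ≤ m j := by
      have := hm0 j
      omega
    obtain ⟨y, hy⟩ := hb.exists_dual fun k => if k = j then 1 else 0
    set ω := ∑ k, y k • b k
    have hω : ∀ α ∈ Δ, ⟪ω, α⟫ = c j α := fun α hα => by
      rw [hb.inner_eq_sum hα]
      simp [hy]
    have hx' : ∀ α ∈ Δ, ⟪x - (2 : ℝ) • w ω, w α⟫ = ⟪x, w α⟫ - 2 * c j α := fun α hα => by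
      rw [inner_sub_left, real_inner_smul_left, w.inner_map_map, hω α hα]
    have hPx' : P (x - (2 : ℝ) • w ω) := by
      intro α hα
      have hw' : w (w⁻¹ α) = α := w.apply_symm_apply α
      have hα' := (hΔ.weylGroup_mem_iff (inv_mem hw) α).mpr hα
      obtain ⟨n, hn, hpn⟩ := hx α hα
      have h := hx' _ hα'
      rw [hw'] at h
      exact ⟨n - 2 * c j (w⁻¹ α), by rw [h, hn]; push_cast; rfl, by rw [hpn]; simp [Int.even_sub]⟩
    have hE := hmin _ hPx'
    simp only [E] at hE
    rw [← hΔ.sum_comp_weylGroup hw fun α => ⟪x, α⟫ ^ 2,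
      ← hΔ.sum_comp_weylGroup hw fun α => ⟪x - (2 : ℝ) • w ω, α⟫ ^ 2] at hE
    refine absurd hE (not_le.mpr ?_)
    have hsplit : ∀ α, c j α * ((∑ k, c k α * m k) - c j α) =
        ∑ k, c j α * c k α * (m k - if k = j then 1 else 0) := fun α => by
      simp only [mul_sub, Finset.sum_sub_distrib, Finset.mul_sum, mul_assoc]
      simp
    have hm' : ∀ k, 0 ≤ m k - if k = j then 1 else 0 := fun k => by
      split_ifs with h
      · subst h; omega
      · simpa using hm0 k
    have hsame : ∀ α ∈ Δ, ∀ k, 0 ≤ c j α * c k α := fun α hα k =>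
      (hb.sign α hα).elim (fun h => mul_nonneg (h j) (h k))
        fun h => mul_nonneg_of_nonpos_of_nonpos (h j) (h k)
    have hdiff : ∀ α ∈ Δ, ⟪x, w α⟫ ^ 2 - ⟪x - (2 : ℝ) • w ω, w α⟫ ^ 2 =
        4 * ((c j α * ((∑ k, c k α * m k) - c j α) : ℤ) : ℝ) := fun α hα => by
      rw [hx' α hα, hL α hα]
      push_cast
      ring
    refine Finset.sum_lt_sum (fun α hα => ?_) ⟨θ, hΔ.finite.mem_toFinset.mpr hθ, ?_⟩
    · have hα := hΔ.finite.mem_toFinset.mp hα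
      have : (0 : ℤ) ≤ c j α * ((∑ k, c k α * m k) - c j α) := by
        rw [hsplit]
        exact Finset.sum_nonneg fun k _ => mul_nonneg (hsame α hα k) (hm' k)
      have : (0 : ℝ) ≤ ((c j α * ((∑ k, c k α * m k) - c j α) : ℤ) : ℝ) := by exact_mod_cast this
      linarith [hdiff α hα]
    · have : (0 : ℤ) < c j θ * ((∑ k, c k θ * m k) - c j θ) := by
        rw [hsplit]
        refine Finset.sum_pos' (fun k _ => mul_nonneg (hsame θ hθ k) (hm' k))
          ⟨i, Finset.mem_univ i, ?_⟩
        rw [if_neg hji.symm, sub_zero]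
        exact mul_pos (mul_pos (hc1 j) (hc1 i)) hmi
      have : (0 : ℝ) < ((c j θ * ((∑ k, c k θ * m k) - c j θ) : ℤ) : ℝ) := by exact_mod_cast this
      linarith [hdiff θ hθ]
  refine ⟨w, hw, i, ?_, fun α hα => ?_⟩
  · rw [hmi1, mul_one] at hi2
    have := hc1 i
    omega
  · rw [hpL α hα, Finset.sum_eq_single i (fun j _ hj => by rw [hzero j hj, mul_zero]) (by simp),
      hmi1, mul_one]

end IsRootBase

/-- For subgroups of the Weyl group, largeness means that the roots whose reflection lies in the
subgroup are cut out by a parity condition. -/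
theorem IsLarge.reflMem_add_iff {Δ : Set V} (hΔ : IsSimplyLaced Δ) {r : ℕ} {b : Fin r → V}
    {c : Fin r → V → ℤ} (hb : IsRootBase Δ b c) {Γ : Subgroup (V ≃ₗᵢ[ℝ] V)}
    (hΓ : Γ ≤ weylGroup Δ) (hlarge : IsLarge Δ Γ) {α β : V} (hα : α ∈ Δ) (hβ : β ∈ Δ)
    (h : 2 * ⟪α, β⟫ = -⟪α, α⟫) :
    reflMem Γ (α + β) ↔ (reflMem Γ α ↔ reflMem Γ β) := by
  have hN := hΔ.inner_self_pos hα
  have hsα : sFun α β = α + β := by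
    rw [hΔ.sFun_eq (n := -1) hα (by rw [real_inner_comm, h]; ring)]
    module
  have hsβ : sFun β α = α + β := by
    rw [hΔ.sFun_eq (n := -1) hβ (by rw [h, hΔ.inner_self_eq hα hβ]; ring)]
    module
  have hsα' : sFun α (α + β) = β := by rw [← hsα, sFun_sFun]
  have hsβ' : sFun β (α + β) = α := by rw [← hsβ, sFun_sFun]
  by_cases hpα : reflMem Γ α
  · have h₁ : reflMem Γ β → reflMem Γ (α + β) := fun hpβ => hsα ▸ reflMem_sFun hpα hpβ
    have h₂ : reflMem Γ (α + β) → reflMem Γ β := fun hp => hsα' ▸ reflMem_sFun hpα hp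
    tauto
  · by_cases hpβ : reflMem Γ β
    · have h₂ : reflMem Γ (α + β) → reflMem Γ α := fun hp => hsβ' ▸ reflMem_sFun hpβ hp
      tauto
    · obtain ⟨γ, hγ0, ⟨s, t, hst⟩, hγ⟩ := hlarge α hα β hβ
        (by rintro rfl; linarith) (by rintro rfl; rw [inner_neg_right] at h; linarith)
        (fun h0 => by rw [h0] at h; linarith)
      have := hb.reflMem_of_mem_plane hΔ hΓ hα hβ h hγ0 hst hγ
      tauto

theorem isLarge_of_reflMem {Δ : Set V} (hΔ : IsSimplyLaced Δ) {Γ : Subgroup (V ≃ₗᵢ[ℝ] V)}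
    (hΓ : ∀ α ∈ Δ, ∀ β ∈ Δ, 2 * ⟪α, β⟫ = -⟪α, α⟫ →
      reflMem Γ α ∨ reflMem Γ β ∨ reflMem Γ (α + β)) : IsLarge Δ Γ := by
  intro α hα β hβ hβα hβα' hαβ
  have ne0 : ∀ {v : V}, v ∈ Δ → v ≠ 0 := fun hv h0 => hΔ.zero_notMem (h0 ▸ hv)
  obtain ⟨n, hn, hn1, hn2, hn3, hn4⟩ := hΔ.exists_cartan hα hβ
  have h0 : n ≠ 0 := by
    rintro rfl
    exact hαβ (by simpa using hn)
  have h2 : n ≠ 2 := fun h => hβα (hn3 h)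
  have h2' : n ≠ -2 := fun h => hβα' (hn4 h)
  obtain rfl | rfl : n = 1 ∨ n = -1 := by omega
  · have h : 2 * ⟪α, -β⟫ = -⟪α, α⟫ := by
      rw [inner_neg_right, mul_neg, hn]
      simp
    have hβ' := hΔ.neg_mem hβ
    rcases hΓ α hα (-β) hβ' h with hp | hp | hp
    · exact ⟨α, ne0 hα, ⟨1, 0, by module⟩, hp⟩
    · exact ⟨-β, ne0 hβ', ⟨0, -1, by module⟩, hp⟩
    · exact ⟨α + -β, ne0 (hΔ.add_mem hα hβ' h), ⟨1, -1, by module⟩, hp⟩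
  · have h : 2 * ⟪α, β⟫ = -⟪α, α⟫ := by
      rw [hn]
      simp
    rcases hΓ α hα β hβ h with hp | hp | hp
    · exact ⟨α, ne0 hα, ⟨1, 0, by module⟩, hp⟩
    · exact ⟨β, ne0 hβ, ⟨0, 1, by module⟩, hp⟩
    · exact ⟨α + β, ne0 (hΔ.add_mem hα hβ h), ⟨1, 1, by module⟩, hp⟩

/-- A Weyl group element carries the roots satisfying `p` to those satisfying `q` if and only if
it carries `p` to `q`. -/
theorem weylGroup_image_eq_iff {Δ : Set V} (hΔ : IsSimplyLaced Δ) {w : V ≃ₗᵢ[ℝ] V}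
    (hw : w ∈ weylGroup Δ) {p q : V → Prop} :
    w '' {α ∈ Δ | p α} = {α ∈ Δ | q α} ↔ ∀ α ∈ Δ, (p α ↔ q (w α)) := by
  refine ⟨fun h α hα => ?_, fun h => Set.ext fun α => ⟨?_, fun hα => ?_⟩⟩
  · have hα' : w α ∈ w '' {α ∈ Δ | p α} ↔ w α ∈ {α ∈ Δ | q α} := by rw [h]
    rw [w.injective.mem_set_image] at hα'
    simpa [hα, hΔ.weylGroup_mem_iff hw] using hα'
  · rintro ⟨β, ⟨hβ, hpβ⟩, rfl⟩
    exact ⟨(hΔ.weylGroup_mem_iff hw β).mpr hβ, (h β hβ).mp hpβ⟩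
  · obtain ⟨β, rfl⟩ := w.surjective α
    have hβ := (hΔ.weylGroup_mem_iff hw β).mp hα.1
    exact ⟨β, ⟨hβ, (h β hβ).mpr hα.2⟩, rfl⟩

theorem exists_not_reflMem {Δ : Set V} {Γ : Subgroup (V ≃ₗᵢ[ℝ] V)} (hΓ : Γ < weylGroup Δ) :
    ∃ α ∈ Δ, ¬ reflMem Γ α := by
  by_contra! hall
  refine hΓ.not_ge ((Subgroup.closure_le Γ).mpr ?_)
  rintro w ⟨α, hα, hw⟩
  obtain ⟨u, hu, hux⟩ := hall α hα
  rwa [show w = u from LinearIsometryEquiv.ext fun x => (hw x).trans (hux x).symm]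

end RootSystems

theorem stmt5 {V : Type*} [NormedAddCommGroup V] [InnerProductSpace ℝ V]
    [FiniteDimensional ℝ V]
    (Δ : Set V) (hfin : Δ.Finite) (h0 : (0 : V) ∉ Δ)
    (hrefl : ∀ α ∈ Δ, ∀ β ∈ Δ, sFun α β ∈ Δ)
    (hcrys : ∀ α ∈ Δ, ∀ β ∈ Δ, ∃ n : ℤ, 2 * ⟪β, α⟫ = (n : ℝ) * ⟪α, α⟫)
    (hred : ∀ α ∈ Δ, ∀ t : ℝ, t • α ∈ Δ → t • α = α ∨ t • α = -α)
    -- simply laced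
    (hsl : ∀ α ∈ Δ, ∀ β ∈ Δ, ‖α‖ = ‖β‖)
    -- irreducible
    (hne : Δ.Nonempty)
    (hirr : ∀ A B : Set V, Δ = A ∪ B → Disjoint A B →
      (∀ a ∈ A, ∀ b ∈ B, ⟪a, b⟫ = 0) → A = ∅ ∨ B = ∅)
    -- base `α₁, …, α_r` with coefficient functions `c i` and rank `r > 1`
    (r : ℕ) (hr : 1 < r) (b : Fin r → V) (hbΔ : ∀ i, b i ∈ Δ)
    (hli : LinearIndependent ℝ b)
    (c : Fin r → V → ℤ)
    (hrep : ∀ α ∈ Δ, α = ∑ i, (c i α : ℝ) • b i)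
    (hsign : ∀ α ∈ Δ, (∀ i, 0 ≤ c i α) ∨ (∀ i, c i α ≤ 0))
    -- highest root `θ`, so that `n i = c i θ`
    (θ : V) (hθ : θ ∈ Δ) (hhigh : ∀ α ∈ Δ, ∀ i, c i α ≤ c i θ)
    -- `Γ` is a proper subgroup of the Weyl group
    (Γ : Subgroup (V ≃ₗᵢ[ℝ] V)) (hΓ : Γ < weylGroup Δ) :
    IsLarge Δ Γ ↔
      ∃ w ∈ weylGroup Δ, ∃ i : Fin r,
        (c i θ = 1 ∧ (⇑w) '' {δ ∈ Δ | reflMem Γ δ} = {α ∈ Δ | c i α = 0}) ∨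
        (c i θ = 2 ∧ (⇑w) '' {δ ∈ Δ | reflMem Γ δ} = {α ∈ Δ | (2 : ℤ) ∣ c i α}) := by
  have hΔ : IsSimplyLaced Δ := ⟨hfin, h0, hrefl, hcrys, hsl⟩
  have hb : IsRootBase Δ b c := ⟨hbΔ, hli, hrep, hsign⟩
  have heven : ∀ i, c i θ = 1 → ∀ α ∈ Δ, (c i α = 0 ↔ Even (c i α)) := by
    intro i hi α hα
    have hα' := hΔ.neg_mem hα
    have h₁ := hhigh α hα i
    have h₂ := hhigh _ hα' i
    rw [hb.coeff_neg hα hα'] at h₂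
    rw [Int.even_iff]
    omega
  constructor
  · intro hlarge
    obtain ⟨w, hw, i, hi, hpi⟩ := hb.exists_even_coeff_iff hΔ hθ hhigh (p := reflMem Γ)
      reflMem_neg_iff
      (fun α hα β hβ h => hlarge.reflMem_add_iff hΔ hb hΓ.le hα hβ h) (exists_not_reflMem hΓ)
    have hw' := inv_mem hw
    have hpi' : ∀ α ∈ Δ, (reflMem Γ α ↔ Even (c i (w⁻¹ α))) := fun α hα => by
      rw [← hpi _ ((hΔ.weylGroup_mem_iff hw' α).mpr hα),
        show w (w⁻¹ α) = α from w.apply_symm_apply α]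
    refine ⟨w⁻¹, hw', i, hi.imp (fun h => ⟨h, ?_⟩) fun h => ⟨h, ?_⟩⟩
    · refine (weylGroup_image_eq_iff hΔ hw').mpr fun α hα => ?_
      rw [hpi' α hα, heven i h _ ((hΔ.weylGroup_mem_iff hw' α).mpr hα)]
    · refine (weylGroup_image_eq_iff hΔ hw').mpr fun α hα => ?_
      rw [hpi' α hα, even_iff_two_dvd]
  · rintro ⟨w, hw, i, hi⟩
    have hwΔ : ∀ {α}, α ∈ Δ → w α ∈ Δ := (hΔ.weylGroup_mem_iff hw _).mpr
    have hpi : ∀ α ∈ Δ, (reflMem Γ α ↔ Even (c i (w α))) := by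
      rcases hi with ⟨hi, him⟩ | ⟨-, him⟩ <;> intro α hα <;>
        rw [(weylGroup_image_eq_iff hΔ hw).mp him α hα]
      · exact heven i hi _ (hwΔ hα)
      · exact even_iff_two_dvd.symm
    refine isLarge_of_reflMem hΔ fun α hα β hβ h => ?_
    have hαβ := hΔ.add_mem hα hβ h
    have hwαβ := hwΔ hαβ
    rw [hpi α hα, hpi β hβ, hpi _ hαβ]
    rw [map_add] at hwαβ ⊢
    rw [hb.coeff_add (hwΔ hα) (hwΔ hβ) hwαβ, Int.even_add]
    tauto
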